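/- Let q > 2 be a power of 2 and c_0, c_1 ∈ F_q with c_0 ≠ 0, c_1 ≠ 0 and c_0 ≠ 1. Let F : F_q → F_q be given by F(x) = ((c_0·x)^{q−2} + c_1)^{q−2} + x. Then the value set V_F = {F(c) : c ∈ F_q} has cardinality #V_F = q/2 + Tr(c_0) + Tr(c_0^{−1}), where Tr(c_0) and Tr(c_0^{−1}) are interpreted as the integers 0 or 1. -/

import Mathlib

open scoped Classical

/-- The absolute trace `Tr : F_{2^m} → F_2 ⊆ F_{2^m}`, `Tr(x) = ∑_{i<m} x^{2^i}`. -/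
def absTr {K : Type*} [Field K] (m : ℕ) (x : K) : K :=
  ∑ i ∈ Finset.range m, x ^ 2 ^ i

open Polynomial in
/-- At most `2 ^ n` elements of a field satisfy `∑_{i ≤ n} x ^ 2 ^ i = 0`. -/
theorem ncard_absTr_eq_zero_le {K : Type*} [Field K] (n : ℕ) :
    {x : K | absTr (n + 1) x = 0}.ncard ≤ 2 ^ n := by
  set p : K[X] := ∑ i ∈ Finset.range (n + 1), X ^ 2 ^ i with hp
  have hdeg : p.natDegree ≤ 2 ^ n := by
    refine natDegree_sum_le_of_forall_le _ _ fun i hi => ?_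
    rw [natDegree_X_pow]
    exact Nat.pow_le_pow_right two_pos (Nat.lt_succ_iff.mp (Finset.mem_range.mp hi))
  have hp0 : p ≠ 0 := by
    intro h
    have h1 : p.coeff 1 = 1 := by
      rw [hp, finsetSum_coeff, Finset.sum_eq_single 0]
      · simp
      · intro i _ hi
        rw [coeff_X_pow, if_neg]
        exact (Nat.one_lt_two_pow hi).ne
      · simp
    simp [h] at h1
  have hsub : {x : K | absTr (n + 1) x = 0} ⊆ (p.roots.toFinset : Set K) := by
    intro x hx
    simp only [Finset.mem_coe, Multiset.mem_toFinset, mem_roots hp0, IsRoot.def]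
    simpa [hp, absTr, eval_finsetSum] using hx
  calc _ ≤ (p.roots.toFinset : Set K).ncard := Set.ncard_le_ncard hsub (Finset.finite_toSet _)
    _ = p.roots.toFinset.card := Set.ncard_coe_finset _
    _ ≤ p.natDegree := (Multiset.toFinset_card_le _).trans (card_roots' p)
    _ ≤ 2 ^ n := hdeg

/-- The Artin–Schreier map `z ↦ z² + z` in characteristic two. -/
def artinSchreierTwo (K : Type*) [Field K] [CharP K 2] : K →+ K where
  toFun z := z ^ 2 + z
  map_zero' := by simp
  map_add' a b := by rw [add_pow_char]; ring

theorem two_mul_ncard_range_artinSchreierTwo (K : Type*) [Field K] [CharP K 2] [Fintype K] :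
    2 * (Set.range (artinSchreierTwo K)).ncard = Fintype.card K := by
  have hker : ((artinSchreierTwo K).ker : Set K) = {0, 1} := by
    ext z
    have : z ^ 2 + z = z * (z - 1) + 2 * z := by ring
    simp only [SetLike.mem_coe, AddMonoidHom.mem_ker, Set.mem_insert_iff, Set.mem_singleton_iff]
    change z ^ 2 + z = 0 ↔ _
    rw [this, CharTwo.two_eq_zero, zero_mul, add_zero, mul_eq_zero, sub_eq_zero]
  have h1 : Nat.card (artinSchreierTwo K).ker = 2 := by
    change Nat.card ((artinSchreierTwo K).ker : Set K) = 2
    rw [Nat.card_coe_set_eq, hker, Set.ncard_pair zero_ne_one]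
  have h2 := AddSubgroup.card_mul_index (artinSchreierTwo K).ker
  rw [AddSubgroup.index_ker, h1, Nat.card_eq_fintype_card (α := K)] at h2
  exact h2

theorem absTr_sq_add_self {K : Type*} [Field K] [CharP K 2] (m : ℕ) (z : K) :
    absTr m (z ^ 2 + z) = z ^ 2 ^ m - z := by
  induction m with
  | zero => simp [absTr]
  | succ m ih =>
    rw [absTr, Finset.sum_range_succ, ← absTr, ih, add_pow_char_pow, ← pow_mul, ← pow_succ']
    linear_combination z ^ 2 ^ m * CharTwo.two_eq_zero (R := K)

theorem mem_range_artinSchreierTwo_iff {K : Type*} [Field K] [CharP K 2] [Fintype K] {m : ℕ}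
    (hcard : Fintype.card K = 2 ^ m) (a : K) :
    a ∈ Set.range (artinSchreierTwo K) ↔ absTr m a = 0 := by
  obtain _ | n := m
  · exact absurd hcard Fintype.one_lt_card.ne'
  have hsub : Set.range (artinSchreierTwo K) ⊆ {x : K | absTr (n + 1) x = 0} := by
    rintro _ ⟨z, rfl⟩
    change absTr (n + 1) (z ^ 2 + z) = 0
    rw [absTr_sq_add_self, ← hcard, FiniteField.pow_card, sub_self]
  have hle : {x : K | absTr (n + 1) x = 0}.ncard ≤ (Set.range (artinSchreierTwo K)).ncard := by
    have h1 := two_mul_ncard_range_artinSchreierTwo K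
    have h2 := ncard_absTr_eq_zero_le (K := K) n
    rw [hcard, pow_succ] at h1
    omega
  exact Set.ext_iff.mp (Set.eq_of_subset_of_ncard_le hsub hle (Set.toFinite _)) a

theorem FiniteField.pow_card_sub_two {K : Type*} [Field K] [Fintype K]
    (h : 2 < Fintype.card K) (x : K) : x ^ (Fintype.card K - 2) = x⁻¹ := by
  obtain rfl | hx := eq_or_ne x 0
  · rw [zero_pow (by omega), inv_zero]
  · refine eq_inv_of_mul_eq_one_left ?_
    rw [← pow_succ, show Fintype.card K - 2 + 1 = Fintype.card K - 1 by omega,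
      FiniteField.pow_card_sub_one_eq_one x hx]

/-- Membership in the value set of `y ↦ y + c / y` on the nonzero elements of a finite field of
characteristic two. -/
theorem exists_add_div_eq_iff {K : Type*} [Field K] [CharP K 2] [Fintype K] {c : K} (hc : c ≠ 0)
    (t : K) : (∃ y ≠ 0, y + c / y = t) ↔ c * (t⁻¹) ^ 2 ∈ Set.range (artinSchreierTwo K) := by
  have h2 : (2 : K) = 0 := CharTwo.two_eq_zero
  obtain rfl | ht := eq_or_ne t 0
  · obtain ⟨y, hy⟩ := (bijective_frobenius K 2).surjective c
    rw [frobenius_def] at hy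
    refine iff_of_true ⟨y, ?_, ?_⟩ ⟨0, by simp⟩
    · rintro rfl
      exact hc (by rw [← hy]; simp)
    · have hy0 : y ≠ 0 := by
        rintro rfl
        exact hc (by rw [← hy]; simp)
      rw [← hy]
      field_simp
      linear_combination y * h2
  constructor
  · rintro ⟨y, hy, rfl⟩
    refine ⟨y / (y + c / y), ?_⟩
    change (y / (y + c / y)) ^ 2 + y / (y + c / y) = _
    have hD : y ^ 2 + c ≠ 0 := by
      intro h
      apply ht
      field_simp
      simpa using h
    field_simp
    linear_combination y ^ 2 * h2
  · rintro ⟨z, hz⟩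
    change z ^ 2 + z = _ at hz
    have hz0 : z ≠ 0 := by
      rintro rfl
      have : c * t⁻¹ ^ 2 ≠ 0 := by positivity
      simp_all
    refine ⟨t * z, mul_ne_zero ht hz0, ?_⟩
    field_simp at hz ⊢
    linear_combination (-1) * hz + t ^ 2 * z ^ 2 * h2

/-- Up to an affine change of coordinates, the value set is that of `y ↦ y + c₀ / y` on the nonzero
elements, enlarged by `1` and `c₀`. -/
theorem range_inv_inv_add_eq_image {K : Type*} [Field K] [CharP K 2] [Fintype K] {c₀ c₁ : K}
    (hc₀ : c₀ ≠ 0) (hc₁ : c₁ ≠ 0) (hne : c₀ ≠ 1) :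
    Set.range (fun x : K => ((c₀ * x)⁻¹ + c₁)⁻¹ + x) =
      (fun t => (t + (c₀ + 1)) * (c₀ * c₁)⁻¹) ''
        insert 1 (insert c₀ {t | ∃ y ≠ 0, y + c₀ / y = t}) := by
  have h2 : (2 : K) = 0 := CharTwo.two_eq_zero
  have hzero : ((c₀ * 0)⁻¹ + c₁)⁻¹ + 0 = (1 + (c₀ + 1)) * (c₀ * c₁)⁻¹ := by
    rw [mul_zero, inv_zero, zero_add, add_zero]
    field_simp
    linear_combination -h2
  have hpole : ((c₀ * (c₀ * c₁)⁻¹)⁻¹ + c₁)⁻¹ + (c₀ * c₁)⁻¹ =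
      (c₀ + (c₀ + 1)) * (c₀ * c₁)⁻¹ := by
    have h : (c₀ * (c₀ * c₁)⁻¹)⁻¹ + c₁ = 0 := by
      field_simp
      linear_combination c₁ * h2
    rw [h, inv_zero]
    linear_combination (-c₀ * (c₀ * c₁)⁻¹) * h2
  have hgen (y : K) (hy : y ≠ 0) (hy1 : y ≠ 1) :
      ((c₀ * ((y + 1) * (c₀ * c₁)⁻¹))⁻¹ + c₁)⁻¹ + (y + 1) * (c₀ * c₁)⁻¹ =
        (y + c₀ / y + (c₀ + 1)) * (c₀ * c₁)⁻¹ := by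
    have hy2 : y + 1 ≠ 0 := fun h => hy1 (by linear_combination h - h2)
    have h : (c₀ * ((y + 1) * (c₀ * c₁)⁻¹))⁻¹ + c₁ = c₁ * y / (y + 1) := by
      field_simp
      linear_combination h2
    rw [h]
    field_simp
    ring
  ext v
  simp only [Set.mem_range, Set.mem_image, Set.mem_insert_iff, Set.mem_ofPred_eq]
  constructor
  · rintro ⟨x, rfl⟩
    obtain ⟨y, rfl⟩ : ∃ y, x = (y + 1) * (c₀ * c₁)⁻¹ := by
      refine ⟨c₀ * c₁ * x + 1, ?_⟩
      field_simp
      linear_combination -h2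
    obtain rfl | hy := eq_or_ne y 0
    · exact ⟨c₀, by simp, by rw [zero_add, one_mul, hpole]⟩
    obtain rfl | hy1 := eq_or_ne y 1
    · refine ⟨1, by simp, ?_⟩
      rw [← hzero, one_add_one_eq_two, h2, zero_mul]
    · exact ⟨_, .inr (.inr ⟨y, hy, rfl⟩), (hgen y hy hy1).symm⟩
  · rintro ⟨t, rfl | rfl | ⟨y, hy, rfl⟩, rfl⟩
    · exact ⟨0, hzero⟩
    · exact ⟨_, hpole⟩
    · obtain rfl | hy1 := eq_or_ne y 1
      · refine ⟨_, (hgen c₀ hc₀ hne).trans ?_⟩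
        rw [div_self hc₀, div_one, add_comm c₀ 1]
      · exact ⟨_, hgen y hy hy1⟩

/-- For `q = 2^m > 2` and `c₀, c₁ ≠ 0` with `c₀ ≠ 1`, the value set of
`F(x) = ((c₀ x)^{q-2} + c₁)^{q-2} + x` over `F_q` has exactly
`q/2 + Tr(c₀) + Tr(c₀⁻¹)` elements, trace values being read as integers `0` or `1`. -/
theorem value_set_card_carlitz_rank_two_char_two
    (q m : ℕ) (hq : 2 < q) (hq2 : q = 2 ^ m)
    (K : Type*) [Field K] [Fintype K] (hcard : Fintype.card K = q)
    (c₀ c₁ : K) (hc₀ : c₀ ≠ 0) (hc₁ : c₁ ≠ 0) (hne : c₀ ≠ 1) :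
    Set.ncard (Set.range (fun x : K => ((c₀ * x) ^ (q - 2) + c₁) ^ (q - 2) + x))
      = q / 2 + (if absTr m c₀ = 0 then 0 else 1)
          + (if absTr m c₀⁻¹ = 0 then 0 else 1) := by
  subst hcard
  have : CharP K 2 := by
    refine CharTwo.of_one_ne_zero_of_two_eq_zero one_ne_zero ?_
    have h := Nat.cast_card_eq_zero K
    rw [hq2, Nat.cast_pow, Nat.cast_ofNat] at h
    exact eq_zero_of_pow_eq_zero h
  set S := Set.range (artinSchreierTwo K)
  have hinj : Function.Injective fun t : K => c₀ * (t⁻¹) ^ 2 := fun a b h =>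
    inv_injective ((bijective_frobenius K 2).injective (mul_left_cancel₀ hc₀ h))
  set V : Set K := {t | ∃ y ≠ 0, y + c₀ / y = t} with hV
  have hmem (t : K) : t ∈ V ↔ absTr m (c₀ * (t⁻¹) ^ 2) = 0 :=
    (exists_add_div_eq_iff hc₀ t).trans (mem_range_artinSchreierTwo_iff hq2 _)
  have hVS : V = (fun t : K => c₀ * (t⁻¹) ^ 2) ⁻¹' S :=
    Set.ext fun t => exists_add_div_eq_iff hc₀ t
  have hVcard : V.ncard = Fintype.card K / 2 := by
    rw [hVS, Set.ncard_preimage_of_injective_subset_range hinj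
      fun s _ => (Finite.injective_iff_surjective.mp hinj) s,
      ← two_mul_ncard_range_artinSchreierTwo K, Nat.mul_div_cancel_left _ two_pos]
  have h1 : 1 ∈ V ↔ absTr m c₀ = 0 := by rw [hmem, inv_one, one_pow, mul_one]
  have hc : c₀ ∈ V ↔ absTr m c₀⁻¹ = 0 := by
    rw [hmem, show c₀ * c₀⁻¹ ^ 2 = c₀⁻¹ by field_simp]
  have hinsert (a : K) (T : Set K) :
      (insert a T).ncard = T.ncard + if a ∈ T then 0 else 1 := by
    split_ifs with h
    · rw [Set.insert_eq_of_mem h, add_zero]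
    · exact Set.ncard_insert_of_notMem h
  have haff : Function.Injective fun t : K => (t + (c₀ + 1)) * (c₀ * c₁)⁻¹ := fun a b h =>
    add_right_cancel (mul_right_cancel₀ (inv_ne_zero (mul_ne_zero hc₀ hc₁)) h)
  simp only [FiniteField.pow_card_sub_two hq]
  rw [range_inv_inv_add_eq_image hc₀ hc₁ hne, Set.ncard_image_of_injective _ haff, ← hV, hinsert,
    hinsert, hVcard, Set.mem_insert_iff, or_iff_right hne.symm]
  simp only [h1, hc]
  exact add_right_comm _ _ _
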